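/- arXiv:2006.15033 — 2 statements merged into one kernel-verified Lean document; each statement's English description precedes it below -/
import Mathlib

section
/- For a positive integer L, the set Z_L := {k ∈ ℤ³ : |k|² = L} is nonempty if and only if L is not of the form 4^a(8b+7) for nonnegative integers a, b. In particular, if L is congruent to 1, 2, 3, 5 or 6 modulo 8, then Z_L is nonempty. -/
open Matrix in
/-- The symmetric matrix with diagonal `a, b, c` and off-diagonal entries `d` (1,2), `e` (1,3),
`f` (2,3) is the Gram matrix of three integer vectors. -/
def IsGramOfIntVectors (a b c d e f : ℤ) : Prop :=
  ∃ u v w : Fin 3 → ℤ, u ⬝ᵥ u = a ∧ v ⬝ᵥ v = b ∧ w ⬝ᵥ w = c ∧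
    u ⬝ᵥ v = d ∧ u ⬝ᵥ w = e ∧ v ⬝ᵥ w = f

namespace IsGramOfIntVectors

variable {a b c d e f : ℤ}

theorem swap (h : IsGramOfIntVectors b a c d f e) : IsGramOfIntVectors a b c d e f := by
  obtain ⟨u, v, w, h1, h2, h3, h4, h5, h6⟩ := h
  exact ⟨v, u, w, h2, h1, h3, by rwa [dotProduct_comm], h6, h5⟩

theorem of_shift (t : ℤ)
    (h : IsGramOfIntVectors a (b + 2 * d * t + a * t ^ 2) c (d + t * a) e (f + t * e)) :
    IsGramOfIntVectors a b c d e f := by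
  obtain ⟨u, v, w, h1, h2, h3, h4, h5, h6⟩ := h
  refine ⟨u, v - t • u, w, h1, ?_, h3, ?_, h5, ?_⟩ <;>
    simp only [dotProduct, Fin.sum_univ_three, Pi.sub_apply, Pi.smul_apply, smul_eq_mul] at *
  · linear_combination h2 - 2 * t * h4 + t ^ 2 * h1
  · linear_combination h4 - t * h1
  · linear_combination h6 - t * h5

theorem of_unimodular {p q r s : ℤ} (hdet : p * s - q * r = 1)
    (h : IsGramOfIntVectors a (b * p ^ 2 + 2 * f * p * r + c * r ^ 2)
      (b * q ^ 2 + 2 * f * q * s + c * s ^ 2) (d * p + e * r) (d * q + e * s)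
      (b * p * q + f * (p * s + q * r) + c * r * s)) :
    IsGramOfIntVectors a b c d e f := by
  obtain ⟨u, v, w, h1, h2, h3, h4, h5, h6⟩ := h
  refine ⟨u, s • v - r • w, p • w - q • v, h1, ?_, ?_, ?_, ?_, ?_⟩ <;>
    simp only [dotProduct, Fin.sum_univ_three, Pi.sub_apply, Pi.smul_apply, smul_eq_mul] at *
  · linear_combination s ^ 2 * h2 - 2 * r * s * h6 + r ^ 2 * h3 +
      (p * s - q * r + 1) * b * hdet
  · linear_combination q ^ 2 * h2 - 2 * p * q * h6 + p ^ 2 * h3 +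
      (p * s - q * r + 1) * c * hdet
  · linear_combination s * h4 - r * h5 + d * hdet
  · linear_combination p * h5 - q * h4 + e * hdet
  · linear_combination (p * s + q * r) * h6 - q * s * h2 - p * r * h3 +
      (p * s - q * r + 1) * f * hdet

end IsGramOfIntVectors

theorem Int.exists_two_mul_add_mul_sq_le (d : ℤ) {a : ℤ} (ha : 0 < a) :
    ∃ t : ℤ, 4 * (d + t * a) ^ 2 ≤ a ^ 2 := by
  refine ⟨-((2 * d + a) / (2 * a)), ?_⟩
  have h1 := Int.emod_add_mul_ediv (2 * d + a) (2 * a)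
  have h2 := Int.emod_nonneg (2 * d + a) (show 2 * a ≠ 0 by lia)
  have h3 := Int.emod_lt_of_pos (2 * d + a) (show 0 < 2 * a by lia)
  generalize (2 * d + a) / (2 * a) = k at *
  generalize (2 * d + a) % (2 * a) = r at *
  have h4 : 2 * (d + -k * a) = r - a := by linear_combination -h1
  have h5 : 4 * (d + -k * a) ^ 2 = (r - a) ^ 2 := by rw [← h4]; ring
  rw [h5]
  nlinarith

/-- Reduction of positive definite binary quadratic forms. -/
theorem exists_unimodular_three_mul_sq_le (a b c : ℤ) (ha : 0 < a) (hD : 0 < a * c - b ^ 2) :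
    ∃ p q r s : ℤ, p * s - q * r = 1 ∧
      3 * (a * p ^ 2 + 2 * b * p * r + c * r ^ 2) ^ 2 ≤ 4 * (a * c - b ^ 2) ∧
      0 < a * p ^ 2 + 2 * b * p * r + c * r ^ 2 := by
  induction hn : a.toNat using Nat.strong_induction_on generalizing a b c with
  | _ n ih =>
    obtain ⟨t, ht⟩ := Int.exists_two_mul_add_mul_sq_le b ha
    have hD' : a * (c + 2 * b * t + a * t ^ 2) - (b + t * a) ^ 2 = a * c - b ^ 2 := by ring
    have hc : 0 < c + 2 * b * t + a * t ^ 2 := by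
      by_contra! h
      nlinarith [sq_nonneg (b + t * a)]
    by_cases hlt : c + 2 * b * t + a * t ^ 2 < a
    · obtain ⟨p, q, r, s, h1, h2, h3⟩ := ih _ (by lia) (c + 2 * b * t + a * t ^ 2)
        (-(b + t * a)) a hc (by linarith) rfl
      refine ⟨t * p - r, t * q - s, p, q, by linear_combination h1, ?_, ?_⟩
      · convert h2 using 1 <;> ring
      · convert h3 using 1; ring
    · refine ⟨1, 0, 0, 1, by ring, ?_, by simpa⟩
      simp only [not_lt] at hlt
      nlinarith

/-- A positive definite ternary form with leading coefficient and determinant one is a sum of three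
squares of linear forms. -/
theorem isGramOfIntVectors_of_leading_eq_one {b c d e f : ℤ} (hm : 0 < b - d ^ 2)
    (hdet : b * c + 2 * d * e * f - f ^ 2 - b * e ^ 2 - c * d ^ 2 = 1) :
    IsGramOfIntVectors 1 b c d e f := by
  have hD : (b - d ^ 2) * (c - e ^ 2) - (f - d * e) ^ 2 = 1 := by linear_combination hdet
  obtain ⟨p, q, r, s, -, h2, h3⟩ := exists_unimodular_three_mul_sq_le (b - d ^ 2) (f - d * e)
    (c - e ^ 2) hm (by lia)
  rw [hD] at h2
  have h1 : (b - d ^ 2) * p ^ 2 + 2 * (f - d * e) * p * r + (c - e ^ 2) * r ^ 2 = 1 := by nlinarith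
  refine ⟨![1, 0, 0], ![d, (b - d ^ 2) * p + (f - d * e) * r, -r],
    ![e, (f - d * e) * p + (c - e ^ 2) * r, p], ?_, ?_, ?_, ?_, ?_, ?_⟩ <;>
    simp [dotProduct, Fin.sum_univ_three]
  · linear_combination (b - d ^ 2) * h1 - r ^ 2 * hD
  · linear_combination (c - e ^ 2) * h1 - p ^ 2 * hD
  · linear_combination (f - d * e) * h1 + p * r * hD

theorem isGramOfIntVectors_of_det_eq_one (a b c d e f : ℤ) (ha : 0 < a) (hm : 0 < a * b - d ^ 2)
    (hdet : a * b * c + 2 * d * e * f - a * f ^ 2 - b * e ^ 2 - c * d ^ 2 = 1) :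
    IsGramOfIntVectors a b c d e f := by
  induction hn : a.toNat using Nat.strong_induction_on generalizing a b c d e f with
  | _ n ih =>
    have hD : (a * b - d ^ 2) * (a * c - e ^ 2) - (a * f - d * e) ^ 2 = a := by
      linear_combination a * hdet
    obtain ⟨p, q, r, s, h1, h2, h3⟩ := exists_unimodular_three_mul_sq_le (a * b - d ^ 2)
      (a * f - d * e) (a * c - e ^ 2) hm (by lia)
    rw [hD] at h2
    refine .of_unimodular h1 ?_
    have hK : (a * b - d ^ 2) * p ^ 2 + 2 * (a * f - d * e) * p * r + (a * c - e ^ 2) * r ^ 2 =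
        a * (b * p ^ 2 + 2 * f * p * r + c * r ^ 2) - (d * p + e * r) ^ 2 := by ring
    rw [hK] at h2 h3
    have hdet' : a * (b * p ^ 2 + 2 * f * p * r + c * r ^ 2) *
        (b * q ^ 2 + 2 * f * q * s + c * s ^ 2) + 2 * (d * p + e * r) * (d * q + e * s) *
        (b * p * q + f * (p * s + q * r) + c * r * s) -
        a * (b * p * q + f * (p * s + q * r) + c * r * s) ^ 2 -
        (b * p ^ 2 + 2 * f * p * r + c * r ^ 2) * (d * q + e * s) ^ 2 -
        (b * q ^ 2 + 2 * f * q * s + c * s ^ 2) * (d * p + e * r) ^ 2 = 1 := by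
      linear_combination (p * s - q * r) ^ 2 * hdet + (p * s - q * r + 1) * h1
    generalize b * p ^ 2 + 2 * f * p * r + c * r ^ 2 = b' at *
    generalize b * q ^ 2 + 2 * f * q * s + c * s ^ 2 = c' at *
    generalize d * p + e * r = d' at *
    generalize d * q + e * s = e' at *
    generalize b * p * q + f * (p * s + q * r) + c * r * s = f' at *
    obtain ⟨t, ht⟩ := Int.exists_two_mul_add_mul_sq_le d' ha
    refine .of_shift t ?_
    have hM : a * (b' + 2 * d' * t + a * t ^ 2) - (d' + t * a) ^ 2 = a * b' - d' ^ 2 := by ring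
    have hb : 0 < b' + 2 * d' * t + a * t ^ 2 := by
      by_contra! h
      nlinarith [sq_nonneg (d' + t * a)]
    by_cases hlt : b' + 2 * d' * t + a * t ^ 2 < a
    · refine .swap (ih _ (by lia) _ _ _ _ _ _ hb (by linarith) ?_ rfl)
      linear_combination hdet'
    · have h4 : 3 * a ^ 2 ≤ 4 * (a * b' - d' ^ 2) := by nlinarith
      have h5 : a < 2 := by
        by_contra! h
        have : (3 * a ^ 2) ^ 2 ≤ (4 * (a * b' - d' ^ 2)) ^ 2 :=
          pow_le_pow_left₀ (by positivity) h4 2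
        have : 27 * a ^ 3 ≤ 64 := by
          refine le_of_mul_le_mul_left ?_ ha
          nlinarith
        have : 2 ^ 3 ≤ a ^ 3 := pow_le_pow_left₀ (by norm_num) h 3
        lia
      obtain rfl : a = 1 := by lia
      refine isGramOfIntVectors_of_leading_eq_one (by linarith) ?_
      linear_combination hdet'

/-- If `-b` is a square modulo `b * n - 1`, then `n` is a sum of three squares. -/
theorem exists_sum_three_squares_of_dvd {n b x : ℤ} (hb : 0 < b) (hn : 0 < b * n - 1)
    (h : b * n - 1 ∣ x ^ 2 + b) : ∃ k : Fin 3 → ℤ, k 0 ^ 2 + k 1 ^ 2 + k 2 ^ 2 = n := by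
  obtain ⟨a, ha⟩ := h
  have ha0 : 0 < a := pos_of_mul_pos_right (ha ▸ by positivity) hn.le
  obtain ⟨-, -, w, -, -, hw, -⟩ := isGramOfIntVectors_of_det_eq_one a (b * n - 1) n x 1 0 ha0
    (by linarith) (by linear_combination -n * ha)
  exact ⟨w, by simpa [dotProduct, Fin.sum_univ_three, sq] using hw⟩

open scoped NumberTheorySymbols

theorem exists_dvd_sq_add_of_jacobiSym_eq_one {p b : ℕ} (hp : p.Prime) (h : J(-b | p) = 1) :
    ∃ x : ℤ, (p : ℤ) ∣ x ^ 2 + b := by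
  have := Fact.mk hp
  obtain ⟨y, hy⟩ := ZMod.isSquare_of_jacobiSym_eq_one h
  obtain ⟨x, rfl⟩ := ZMod.intCast_surjective y
  refine ⟨x, (ZMod.intCast_zmod_eq_zero_iff_dvd _ _).1 ?_⟩
  push_cast at hy ⊢
  linear_combination -hy

theorem exists_sum_three_squares_of_mod_four_eq_two {n : ℕ} (hn : n % 4 = 2) :
    ∃ k : Fin 3 → ℤ, k 0 ^ 2 + k 1 ^ 2 + k 2 ^ 2 = (n : ℤ) := by
  have hcop : IsCoprime (n - 1 : ℤ) (4 * n : ℕ) := by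
    push_cast
    refine .mul_right ?_ ⟨-1, 1, by ring⟩
    obtain ⟨k, rfl⟩ : ∃ k, n = 4 * k + 2 := ⟨n / 4, by lia⟩
    exact ⟨1 + 4 * k, -4 * k ^ 2 - 2 * k, by push_cast; ring⟩
  obtain ⟨p, hpn, hp, hmod⟩ :=
    Nat.forall_exists_prime_gt_and_zmodEq n (show 4 * n ≠ 0 by lia) hcop
  obtain ⟨j, hj⟩ := hmod.symm.dvd
  push_cast at hj
  have hj0 : 0 ≤ j := by
    by_contra! h
    nlinarith
  lift j to ℕ using hj0
  have hpb : (p : ℤ) = (4 * j + 1 : ℕ) * n - 1 := by push_cast; linear_combination hj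
  have hp4 : p % 4 = 1 := by
    have : (p : ℤ) = 4 * (n * j) + n - 1 := by linear_combination hj
    lia
  have hodd : Odd (4 * j + 1) := Nat.odd_iff.2 (by lia)
  have hpodd : Odd p := Nat.odd_iff.2 (by lia)
  have hJ : J(-(4 * j + 1 : ℕ) | p) = 1 := by
    rw [jacobiSym.neg _ hpodd, ZMod.χ₄_nat_one_mod_four hp4, one_mul,
      jacobiSym.quadratic_reciprocity_one_mod_four (by lia) hpodd,
      jacobiSym.mod_left' (a₂ := -1) (Int.modEq_iff_dvd.2 ⟨-n, by linear_combination -hpb⟩),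
      jacobiSym.at_neg_one hodd, ZMod.χ₄_nat_one_mod_four (by lia)]
  obtain ⟨x, hx⟩ := exists_dvd_sq_add_of_jacobiSym_eq_one hp hJ
  rw [hpb] at hx
  exact exists_sum_three_squares_of_dvd (by positivity) (hpb ▸ by exact_mod_cast hp.pos) hx

theorem exists_sum_three_squares_of_odd {n c r : ℕ} (hr : c * n = 2 * r + 1) (hr2 : r % 2 = 1)
    (hc : c % 8 = 1 ∨ c % 8 = 3) (h4 : r % 4 = 1 ∨ c % 4 = 3) :
    ∃ k : Fin 3 → ℤ, k 0 ^ 2 + k 1 ^ 2 + k 2 ^ 2 = (n : ℤ) := by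
  have hn0 : n ≠ 0 := by rintro rfl; lia
  have hr' : (c * n : ℤ) = 2 * r + 1 := by exact_mod_cast hr
  have hcop : r.Coprime (4 * n) := by
    refine .mul_right ((Nat.coprime_two_right.2 (Nat.odd_iff.2 hr2)).pow_right 2) ?_
    exact Nat.isCoprime_iff_coprime.1 ⟨-2, c, by linear_combination hr'⟩
  obtain ⟨p, hpn, hp, hmod⟩ :=
    Nat.forall_exists_prime_gt_and_modEq r (show 4 * n ≠ 0 by lia) hcop
  obtain ⟨j, hj⟩ := hmod.symm.dvd
  push_cast at hj
  have hj0 : 0 ≤ j := by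
    by_contra! h
    nlinarith
  lift j to ℕ using hj0
  have hpr : p = 4 * (n * j) + r := by zify; linear_combination hj
  have hpb : (2 * p : ℤ) = (8 * j + c : ℕ) * n - 1 := by
    push_cast
    linear_combination 2 * hj - hr'
  have hodd : Odd (8 * j + c) := Nat.odd_iff.2 (by lia)
  have hpodd : Odd p := Nat.odd_iff.2 (by lia)
  have hflip : J(-(8 * j + c : ℕ) | p) = J(p | 8 * j + c) := by
    rw [jacobiSym.neg _ hpodd]
    rcases Nat.odd_mod_four_iff.1 (Nat.odd_iff.1 hpodd) with h | h
    · rw [ZMod.χ₄_nat_one_mod_four h, one_mul,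
        jacobiSym.quadratic_reciprocity_one_mod_four' hodd h]
    · rw [ZMod.χ₄_nat_three_mod_four h,
        jacobiSym.quadratic_reciprocity_three_mod_four (by lia) h, neg_one_mul, neg_neg]
  have h2 : J(-2 | 8 * j + c) = 1 := by
    rw [jacobiSym.at_neg_two hodd, ZMod.χ₈'_nat_eq_if_mod_eight, if_neg (by lia), if_pos (by lia)]
  have hJ : J(-(8 * j + c : ℕ) | p) = 1 := by
    rw [hflip, ← one_mul (jacobiSym _ _), ← h2, ← jacobiSym.mul_left, h2,
      jacobiSym.mod_left' (a₂ := 1), jacobiSym.one_left]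
    exact Int.modEq_iff_dvd.2 ⟨n, by linear_combination hpb⟩
  obtain ⟨x, hx⟩ : ∃ x : ℤ, (p : ℤ) ∣ x ^ 2 + (8 * j + c : ℕ) ∧ Odd x := by
    obtain ⟨x, hx⟩ := exists_dvd_sq_add_of_jacobiSym_eq_one hp hJ
    rcases Int.even_or_odd x with h | h
    · refine ⟨x + p, ?_, h.add_odd (by exact_mod_cast hpodd)⟩
      rw [show (x + p) ^ 2 + (8 * j + c : ℕ) = x ^ 2 + (8 * j + c : ℕ) + p * (2 * x + p) by ring]
      exact hx.add (dvd_mul_right _ _)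
    · exact ⟨x, hx, h⟩
  refine exists_sum_three_squares_of_dvd (b := (8 * j + c : ℕ)) (x := x)
    (by exact_mod_cast hodd.pos) (hpb ▸ by have := hp.pos; positivity) ?_
  rw [← hpb]
  refine IsCoprime.mul_dvd (Int.isCoprime_iff_gcd_eq_one.2 ?_) ?_ hx.1
  · exact Nat.coprime_two_left.2 hpodd
  · exact (hx.2.pow.add_odd (by exact_mod_cast hodd)).two_dvd

theorem exists_sum_three_squares_of_mod_eight {n : ℕ}
    (hn : n % 8 = 1 ∨ n % 8 = 2 ∨ n % 8 = 3 ∨ n % 8 = 5 ∨ n % 8 = 6) :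
    ∃ k : Fin 3 → ℤ, k 0 ^ 2 + k 1 ^ 2 + k 2 ^ 2 = (n : ℤ) := by
  by_cases h2 : n % 4 = 2
  · exact exists_sum_three_squares_of_mod_four_eq_two h2
  by_cases h3 : n % 8 = 3
  · exact exists_sum_three_squares_of_odd (c := 1) (r := n / 2) (by lia) (by lia) (by lia) (by lia)
  · exact exists_sum_three_squares_of_odd (c := 3) (r := 3 * n / 2) (by lia) (by lia) (by lia)
      (by lia)

theorem exists_sum_three_squares {n : ℕ} (hn : 0 < n)
    (h : ¬ ∃ a b : ℕ, n = 4 ^ a * (8 * b + 7)) :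
    ∃ k : Fin 3 → ℤ, k 0 ^ 2 + k 1 ^ 2 + k 2 ^ 2 = (n : ℤ) := by
  induction n using Nat.strong_induction_on with
  | _ n ih =>
    by_cases h4 : 4 ∣ n
    · obtain ⟨m, rfl⟩ := h4
      obtain ⟨k, hk⟩ := ih m (by lia) (by lia) fun ⟨a, b, hab⟩ =>
        h ⟨a + 1, b, by rw [hab]; ring⟩
      refine ⟨2 • k, ?_⟩
      simp only [Pi.smul_apply, nsmul_eq_mul]
      push_cast
      linear_combination 4 * hk
    · have h7 : n % 8 ≠ 7 := fun h7 => h ⟨0, n / 8, by lia⟩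
      exact exists_sum_three_squares_of_mod_eight (by lia)

theorem sum_three_squares_ne (a b : ℕ) (x y z : ℤ) :
    x ^ 2 + y ^ 2 + z ^ 2 ≠ 4 ^ a * (8 * b + 7) := by
  induction a generalizing x y z with
  | zero =>
    intro h
    have h8 := congrArg (Int.cast : ℤ → ZMod 8) h
    have h0 : (8 : ZMod 8) = 0 := rfl
    push_cast at h8
    rw [h0, zero_mul, zero_add, one_mul] at h8
    have key : ∀ x y z : ZMod 8, x ^ 2 + y ^ 2 + z ^ 2 ≠ 7 := by decide
    exact key _ _ _ h8
  | succ a ih =>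
    intro h
    have hmod : (x ^ 2 + y ^ 2 + z ^ 2) % 4 = 0 := by
      rw [h, pow_succ]
      lia
    have key (w : ℤ) : w ^ 2 % 4 = w % 2 := by
      obtain ⟨v, rfl | rfl⟩ := Int.even_or_odd' w <;> ring_nf <;> lia
    have hx := key x
    have hy := key y
    have hz := key z
    obtain ⟨u, rfl⟩ : 2 ∣ x := by lia
    obtain ⟨v, rfl⟩ : 2 ∣ y := by lia
    obtain ⟨w, rfl⟩ : 2 ∣ z := by lia
    apply ih u v w
    rw [pow_succ _ a] at h
    linarith

/-- Legendre's three-square theorem: for a positive integer `L`, the set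
`Z_L = {k ∈ ℤ³ : |k|² = L}` is nonempty iff `L` is not of the form `4^a(8b+7)`.
In particular, if `L ≡ 1, 2, 3, 5, 6 (mod 8)` then `Z_L` is nonempty. -/
theorem stmt12 (L : ℕ) (hL : 0 < L) :
    ((∃ k : Fin 3 → ℤ, (k 0) ^ 2 + (k 1) ^ 2 + (k 2) ^ 2 = (L : ℤ)) ↔
      ¬ ∃ a b : ℕ, L = 4 ^ a * (8 * b + 7)) ∧
    ((L % 8 = 1 ∨ L % 8 = 2 ∨ L % 8 = 3 ∨ L % 8 = 5 ∨ L % 8 = 6) →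
      ∃ k : Fin 3 → ℤ, (k 0) ^ 2 + (k 1) ^ 2 + (k 2) ^ 2 = (L : ℤ)) := by
  refine ⟨⟨?_, exists_sum_three_squares hL⟩, exists_sum_three_squares_of_mod_eight⟩
  rintro ⟨k, hk⟩ ⟨a, b, rfl⟩
  exact sum_three_squares_ne a b _ _ _ (by exact_mod_cast hk)
end

section
/- Let w be the vector field on ℝ³ ∖ {r = 0} given in cylindrical coordinates (z, r, θ) by w = J₁(r) sin θ · E_z + (J₁(r)/r) cos θ · E_r − (J₁'(r) sin θ / r) · E_θ. Then curl w = w; equivalently, w = (curl∘curl + curl)(J₀(r), 0, 0), and w extends to a smooth Beltrami field on all of ℝ³. -/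
open Real

noncomputable def besselJ0 (r : ℝ) : ℝ :=
  ∑' m : ℕ, (-1) ^ m / ((m.factorial : ℝ) ^ 2) * (r / 2) ^ (2 * m)

noncomputable def besselJ1 (r : ℝ) : ℝ :=
  ∑' m : ℕ, (-1) ^ m / ((m.factorial : ℝ) * ((m + 1).factorial : ℝ)) * (r / 2) ^ (2 * m + 1)

noncomputable def pderiv3 (f : (Fin 3 → ℝ) → ℝ) (i : Fin 3) (x : Fin 3 → ℝ) : ℝ :=
  fderiv ℝ f x (Pi.single i 1)

/-- The curl of a vector field on `ℝ³`. -/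
noncomputable def curl3 (v : (Fin 3 → ℝ) → Fin 3 → ℝ) (x : Fin 3 → ℝ) : Fin 3 → ℝ :=
  ![pderiv3 (fun y => v y 2) 1 x - pderiv3 (fun y => v y 1) 2 x,
    pderiv3 (fun y => v y 0) 2 x - pderiv3 (fun y => v y 2) 0 x,
    pderiv3 (fun y => v y 1) 0 x - pderiv3 (fun y => v y 0) 1 x]

/-- Cylindrical radius. -/
noncomputable def cylr (x : Fin 3 → ℝ) : ℝ := Real.sqrt ((x 0) ^ 2 + (x 1) ^ 2)

/-- The field `w = J₁(r) sin θ E_z + (J₁(r)/r) cos θ E_r − (J₁'(r) sin θ / r) E_θ`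
expressed in Cartesian coordinates, with `cos θ = x₁/r`, `sin θ = x₂/r`,
`E_z = (0,0,1)`, `E_r = (x₁,x₂,0)/r`, `E_θ = (−x₂,x₁,0)`. -/
noncomputable def wfield (x : Fin 3 → ℝ) : Fin 3 → ℝ :=
  (besselJ1 (cylr x) * (x 1 / cylr x)) • (![0, 0, 1] : Fin 3 → ℝ) +
    (besselJ1 (cylr x) / cylr x * (x 0 / cylr x)) •
      (![x 0 / cylr x, x 1 / cylr x, 0] : Fin 3 → ℝ) +
    (-(deriv besselJ1 (cylr x) * (x 1 / cylr x) / cylr x)) •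
      (![-(x 1), x 0, 0] : Fin 3 → ℝ)

/-- The Bessel–Clifford function `u ↦ ∑ uᵐ / (m! (m + k)!)`. -/
noncomputable def besselClifford (k : ℕ) (u : ℝ) : ℝ :=
  ∑' m : ℕ, u ^ m / ((m.factorial : ℝ) * ((m + k).factorial : ℝ))

lemma besselClifford_coeff_le (k m : ℕ) :
    1 / ((m.factorial : ℝ) * ((m + k).factorial : ℝ)) ≤ 1 / (m.factorial : ℝ) := by
  apply one_div_le_one_div_of_le (by positivity)
  exact le_mul_of_one_le_right (by positivity)
    (by exact_mod_cast Nat.one_le_iff_ne_zero.mpr (Nat.factorial_ne_zero _))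

lemma summable_besselClifford (k : ℕ) (u : ℝ) :
    Summable fun m : ℕ => u ^ m / ((m.factorial : ℝ) * ((m + k).factorial : ℝ)) := by
  refine Summable.of_norm_bounded (Real.summable_pow_div_factorial |u|) fun m => ?_
  rw [Real.norm_eq_abs, abs_div, abs_pow, abs_of_pos (by positivity : (0 : ℝ) < _ * _),
    div_eq_mul_one_div, div_eq_mul_one_div (|u| ^ m)]
  exact mul_le_mul_of_nonneg_left (besselClifford_coeff_le k m) (by positivity)

lemma mul_pow_div_factorial_succ (k m : ℕ) (u : ℝ) :
    ((m + 1 : ℕ) : ℝ) * u ^ (m + 1 - 1) /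
        (((m + 1).factorial : ℝ) * ((m + 1 + k).factorial : ℝ)) =
      u ^ m / ((m.factorial : ℝ) * ((m + (k + 1)).factorial : ℝ)) := by
  rw [Nat.factorial_succ m, show m + 1 + k = m + (k + 1) by omega, Nat.add_sub_cancel]
  have : (m.factorial : ℝ) ≠ 0 := by positivity
  have : ((m + (k + 1)).factorial : ℝ) ≠ 0 := by positivity
  push_cast
  field_simp

lemma tsum_mul_pow_div_factorial (k : ℕ) (u : ℝ) :
    ∑' m : ℕ, (m : ℝ) * u ^ (m - 1) / ((m.factorial : ℝ) * ((m + k).factorial : ℝ)) =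
      besselClifford (k + 1) u := by
  have h : Summable fun m : ℕ =>
      (m : ℝ) * u ^ (m - 1) / ((m.factorial : ℝ) * ((m + k).factorial : ℝ)) := by
    rw [← summable_nat_add_iff 1]
    simpa only [mul_pow_div_factorial_succ] using summable_besselClifford (k + 1) u
  rw [h.tsum_eq_zero_add]
  simp only [mul_pow_div_factorial_succ]
  simp [besselClifford]

lemma hasDerivAt_besselClifford (k : ℕ) (u : ℝ) :
    HasDerivAt (besselClifford k) (besselClifford (k + 1) u) u := by
  rw [← tsum_mul_pow_div_factorial]
  have hu : u ∈ Metric.ball (0 : ℝ) (|u| + 1) := by simp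
  have hb : Summable fun m : ℕ => (m : ℝ) * (|u| + 1) ^ (m - 1) /
      ((m.factorial : ℝ) * ((m + k).factorial : ℝ)) := by
    rw [← summable_nat_add_iff 1]
    simpa only [mul_pow_div_factorial_succ] using summable_besselClifford (k + 1) (|u| + 1)
  refine hasDerivAt_tsum_of_isPreconnected hb Metric.isOpen_ball
    (convex_ball (0 : ℝ) _).isPreconnected
    (fun m y _ => (hasDerivAt_pow m y).div_const _) (fun m y hy => ?_) hu
    (summable_besselClifford k u) hu
  have hy' : |y| ≤ |u| + 1 := by simpa using (mem_ball_zero_iff.mp hy).le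
  rw [Real.norm_eq_abs, abs_div, abs_mul, abs_pow, Nat.abs_cast,
    abs_of_pos (by positivity : (0 : ℝ) < _ * _)]
  gcongr

lemma contDiff_besselClifford (k : ℕ) : ContDiff ℝ (⊤ : ℕ∞) (besselClifford k) := by
  have hd (j : ℕ) : deriv (besselClifford j) = besselClifford (j + 1) :=
    funext fun u => (hasDerivAt_besselClifford j u).deriv
  refine contDiff_infty.2 fun n => ?_
  induction n generalizing k with
  | zero =>
    exact contDiff_zero.2 (continuous_iff_continuousAt.2 fun u =>
      (hasDerivAt_besselClifford k u).continuousAt)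
  | succ n ih =>
    push_cast
    refine contDiff_succ_iff_deriv.2
      ⟨fun u => (hasDerivAt_besselClifford k u).differentiableAt, by simp, ?_⟩
    rw [hd]
    exact ih (k + 1)

lemma besselClifford_recurrence (k : ℕ) (u : ℝ) :
    besselClifford k u =
      (k + 1) * besselClifford (k + 1) u + u * besselClifford (k + 2) u := by
  have h : Summable fun m : ℕ =>
      (m : ℝ) * u ^ (m - 1) / ((m.factorial : ℝ) * ((m + (k + 1)).factorial : ℝ)) := by
    rw [← summable_nat_add_iff 1]
    simpa only [mul_pow_div_factorial_succ] using summable_besselClifford (k + 2) u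
  rw [← tsum_mul_pow_div_factorial (k + 1), besselClifford, besselClifford, ← tsum_mul_left,
    ← tsum_mul_left, ← ((summable_besselClifford (k + 1) u).mul_left _).tsum_add (h.mul_left u)]
  refine tsum_congr fun m => ?_
  have hm : u * ((m : ℝ) * u ^ (m - 1)) = m * u ^ m := by
    cases m with
    | zero => simp
    | succ m => simp only [Nat.add_sub_cancel]; ring
  rw [← mul_div_assoc, ← mul_div_assoc, hm, ← add_assoc m k 1, Nat.factorial_succ (m + k)]
  have : (m.factorial : ℝ) ≠ 0 := by positivity
  have : ((m + k).factorial : ℝ) ≠ 0 := by positivity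
  push_cast
  field_simp
  ring

lemma besselJ0_eq_besselClifford (r : ℝ) : besselJ0 r = besselClifford 0 (-r ^ 2 / 4) := by
  refine tsum_congr fun m => ?_
  rw [show -r ^ 2 / 4 = -1 * (r / 2) ^ 2 by ring, mul_pow, ← pow_mul, add_zero]
  ring

lemma besselJ1_eq_besselClifford (r : ℝ) :
    besselJ1 r = r / 2 * besselClifford 1 (-r ^ 2 / 4) := by
  rw [besselJ1, besselClifford, ← tsum_mul_left]
  refine tsum_congr fun m => ?_
  rw [show -r ^ 2 / 4 = -1 * (r / 2) ^ 2 by ring, mul_pow, ← pow_mul]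
  ring

lemma deriv_besselJ1 (r : ℝ) :
    deriv besselJ1 r =
      besselClifford 1 (-r ^ 2 / 4) / 2 - r ^ 2 / 4 * besselClifford 2 (-r ^ 2 / 4) := by
  have hq : HasDerivAt (fun r : ℝ => -r ^ 2 / 4) (-r / 2) r := by
    refine ((hasDerivAt_pow 2 r).neg.div_const 4).congr_deriv ?_
    norm_num
    ring
  rw [funext besselJ1_eq_besselClifford]
  refine (((hasDerivAt_id r).div_const 2).mul
    ((hasDerivAt_besselClifford 1 (-r ^ 2 / 4)).comp r hq)).deriv.trans ?_
  simp only [Function.comp_apply, id]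
  ring

lemma cylr_sq (x : Fin 3 → ℝ) : cylr x ^ 2 = x 0 ^ 2 + x 1 ^ 2 :=
  Real.sq_sqrt (by positivity)

/-- The Bessel–Clifford functions as functions on `ℝ³`, evaluated at `-r² / 4`. -/
noncomputable def cylClifford (k : ℕ) (x : Fin 3 → ℝ) : ℝ :=
  besselClifford k (-(x 0 ^ 2 + x 1 ^ 2) / 4)

lemma contDiff_cylClifford (k : ℕ) : ContDiff ℝ (⊤ : ℕ∞) (cylClifford k) :=
  (contDiff_besselClifford k).comp (by fun_prop)

lemma differentiableAt_cylClifford (k : ℕ) (x : Fin 3 → ℝ) :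
    DifferentiableAt ℝ (cylClifford k) x :=
  (contDiff_cylClifford k).differentiable (by simp) x

lemma cylClifford_recurrence (k : ℕ) (x : Fin 3 → ℝ) :
    cylClifford k x = (k + 1) * cylClifford (k + 1) x -
      (x 0 ^ 2 + x 1 ^ 2) / 4 * cylClifford (k + 2) x := by
  rw [cylClifford, besselClifford_recurrence, cylClifford, cylClifford]
  ring

lemma pderiv3_coord (i j : Fin 3) (x : Fin 3 → ℝ) :
    pderiv3 (fun y => y j) i x = if j = i then 1 else 0 := by
  rw [pderiv3, (hasFDerivAt_apply j x).fderiv]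
  simp [Pi.single_apply]

lemma pderiv3_const (c : ℝ) (i : Fin 3) (x : Fin 3 → ℝ) : pderiv3 (fun _ => c) i x = 0 := by
  simp [pderiv3]

lemma pderiv3_mul {f g : (Fin 3 → ℝ) → ℝ} {x : Fin 3 → ℝ} (hf : DifferentiableAt ℝ f x)
    (hg : DifferentiableAt ℝ g x) (i : Fin 3) :
    pderiv3 (fun y => f y * g y) i x = f x * pderiv3 g i x + g x * pderiv3 f i x := by
  simp [pderiv3, fderiv_fun_mul hf hg]

lemma pderiv3_sub {f g : (Fin 3 → ℝ) → ℝ} {x : Fin 3 → ℝ} (hf : DifferentiableAt ℝ f x)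
    (hg : DifferentiableAt ℝ g x) (i : Fin 3) :
    pderiv3 (fun y => f y - g y) i x = pderiv3 f i x - pderiv3 g i x := by
  simp [pderiv3, fderiv_fun_sub hf hg]

lemma pderiv3_cylClifford (k : ℕ) (i : Fin 3) (x : Fin 3 → ℝ) :
    pderiv3 (fun y => cylClifford k y) i x =
      ![-(x 0) / 2, -(x 1) / 2, 0] i * cylClifford (k + 1) x := by
  have hq : HasFDerivAt (fun y : Fin 3 → ℝ => -(y 0 ^ 2 + y 1 ^ 2) / 4) _ x :=
    ((((hasFDerivAt_apply (𝕜 := ℝ) 0 x).pow 2).add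
      ((hasFDerivAt_apply (𝕜 := ℝ) 1 x).pow 2)).neg.mul_const (4⁻¹ : ℝ))
  have h := (hasDerivAt_besselClifford k (-(x 0 ^ 2 + x 1 ^ 2) / 4)).comp_hasFDerivAt x hq
  rw [pderiv3, show (fun y => cylClifford k y) =
    besselClifford k ∘ fun y : Fin 3 → ℝ => -(y 0 ^ 2 + y 1 ^ 2) / 4 from rfl, h.fderiv]
  fin_cases i <;> simp [cylClifford] <;> ring

/-- The smooth extension of `wfield` to `ℝ³`. -/
noncomputable def smoothField (x : Fin 3 → ℝ) : Fin 3 → ℝ :=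
  ![1 / 2 * cylClifford 1 x - 1 / 4 * (x 1 * (x 1 * cylClifford 2 x)),
    1 / 4 * (x 0 * (x 1 * cylClifford 2 x)),
    1 / 2 * (x 1 * cylClifford 1 x)]

lemma contDiff_smoothField : ContDiff ℝ (⊤ : ℕ∞) smoothField := by
  have h1 := contDiff_cylClifford 1
  have h2 := contDiff_cylClifford 2
  refine contDiff_pi.2 fun i => ?_
  fin_cases i <;> simp only [smoothField] <;> simp <;> fun_prop

lemma smoothField_eq_wfield {x : Fin 3 → ℝ} (hx : cylr x ≠ 0) : smoothField x = wfield x := by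
  have hr := cylr_sq x
  have hc (k : ℕ) : cylClifford k x = besselClifford k (-cylr x ^ 2 / 4) := by
    rw [hr, cylClifford]
  have hx0 : x 0 ^ 2 = cylr x ^ 2 - x 1 ^ 2 := by linarith
  ext i
  fin_cases i <;>
    simp [smoothField, wfield, besselJ1_eq_besselClifford, deriv_besselJ1, hc] <;>
    field_simp
  · rw [hx0]
    ring
  · ring

lemma curl3_smoothField (x : Fin 3 → ℝ) : curl3 smoothField x = smoothField x := by
  have h1 (y) : DifferentiableAt ℝ (fun z => cylClifford 1 z) y := differentiableAt_cylClifford 1 y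
  have h2 (y) : DifferentiableAt ℝ (fun z => cylClifford 2 z) y := differentiableAt_cylClifford 2 y
  have hrec := cylClifford_recurrence 1 x
  ext i
  fin_cases i <;>
    simp (disch := fun_prop) [curl3, smoothField, pderiv3_mul, pderiv3_sub, pderiv3_const,
      pderiv3_coord, pderiv3_cylClifford]
  · ring
  · ring
  · norm_num at hrec
    rw [hrec]
    ring

lemma curl3_besselJ0 (x : Fin 3 → ℝ) :
    curl3 (fun y => ![besselJ0 (cylr y), 0, 0]) x = ![0, 0, 1 / 2 * (x 1 * cylClifford 1 x)] := by
  have hJ (y : Fin 3 → ℝ) : besselJ0 (cylr y) = cylClifford 0 y := by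
    rw [besselJ0_eq_besselClifford, cylr_sq, cylClifford]
  ext i
  fin_cases i <;> simp [curl3, hJ, pderiv3_const, pderiv3_cylClifford]
  ring

lemma smoothField_eq_curl3_curl3_add_curl3 (x : Fin 3 → ℝ) :
    smoothField x =
      curl3 (curl3 (fun y => ![besselJ0 (cylr y), 0, 0])) x +
        curl3 (fun y => ![besselJ0 (cylr y), 0, 0]) x := by
  have h1 (y) : DifferentiableAt ℝ (fun z => cylClifford 1 z) y := differentiableAt_cylClifford 1 y
  rw [funext curl3_besselJ0]
  ext i
  fin_cases i <;>
    simp (disch := fun_prop) [curl3, smoothField, pderiv3_mul, pderiv3_const,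
      pderiv3_coord, pderiv3_cylClifford] <;>
    ring

/-- The field `w` extends to a smooth Beltrami field `W` on all of `ℝ³` satisfying
`curl W = W`; equivalently `W = (curl ∘ curl + curl)(J₀(r), 0, 0)`. -/
theorem stmt16 :
    ∃ W : (Fin 3 → ℝ) → Fin 3 → ℝ,
      ContDiff ℝ (⊤ : ℕ∞) W ∧
      (∀ x : Fin 3 → ℝ, cylr x ≠ 0 → W x = wfield x) ∧
      (∀ x, curl3 W x = W x) ∧
      (∀ x, W x =
        curl3 (curl3 (fun y => ![besselJ0 (cylr y), 0, 0])) x +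
          curl3 (fun y => ![besselJ0 (cylr y), 0, 0]) x) := by
  exact ⟨smoothField, contDiff_smoothField, fun _ => smoothField_eq_wfield, curl3_smoothField,
    smoothField_eq_curl3_curl3_add_curl3⟩
end
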